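/- Let q ≥ 2, and let a, b, m ≥ 2 be integers with gcd(b, q−1) = 1, a ∈ {0,…,b−1}, r ∈ {0,…,m−1}. Then #{n < N : s_q(n) ≡ a (mod b), n ≡ r (mod m)} = N/(bm) + O(N^λ) as N → ∞, where λ = (1/(2 log q))·log( q·sin(π/(2b)) / sin(π/(2bq)) ) < 1, and the implied constant may depend on q, b, m. -/

import Mathlib

open scoped Real

/-- Base-q digit sum. -/
def sqd (q n : ℕ) : ℕ := (Nat.digits q n).sum

/-- Gelfond's exponent `λ = (1/(2 log q))·log(q·sin(π/(2b))/sin(π/(2bq)))`. -/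
noncomputable def gelfondLambda (q b : ℕ) : ℝ :=
  (1 / (2 * Real.log q)) *
    Real.log ((q : ℝ) * Real.sin (π / (2 * b)) / Real.sin (π / (2 * b * q)))

/-- The unit complex number `e^{2ix}`. -/
noncomputable def expTwo (x : ℝ) : ℂ := Complex.exp (Complex.I * ((2 * x : ℝ) : ℂ))

lemma expTwo_add (x y : ℝ) : expTwo (x + y) = expTwo x * expTwo y := by
  simp only [expTwo, ← Complex.exp_add]
  congr 1
  push_cast
  ring

lemma expTwo_pow (x : ℝ) (n : ℕ) : expTwo x ^ n = expTwo (n * x) := by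
  simp only [expTwo, ← Complex.exp_nat_mul]
  congr 1
  push_cast
  ring

lemma norm_expTwo (x : ℝ) : ‖expTwo x‖ = 1 := by
  rw [expTwo, mul_comm]
  exact Complex.norm_exp_ofReal_mul_I _

lemma norm_expTwo_sub_one (x : ℝ) : ‖expTwo x - 1‖ = 2 * |Real.sin x| := by
  rw [expTwo, Complex.norm_exp_I_mul_ofReal_sub_one]
  simp

lemma norm_geom_sum_expTwo_mul (q : ℕ) (x : ℝ) :
    ‖∑ d ∈ Finset.range q, expTwo x ^ d‖ * |Real.sin x| = |Real.sin (q * x)| := by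
  have h := congrArg norm (geom_sum_mul (expTwo x) q)
  rw [norm_mul, expTwo_pow, norm_expTwo_sub_one, norm_expTwo_sub_one] at h
  linarith

lemma norm_geom_sum_expTwo_le (q : ℕ) (x : ℝ) :
    ‖∑ d ∈ Finset.range q, expTwo x ^ d‖ ≤ q := by
  refine (norm_sum_le _ _).trans ?_
  simp [norm_pow, norm_expTwo]

/-- Folding an angle into `[0, π/2]` does not change `|sin|` of its multiples. -/
lemma exists_folded_angle (x : ℝ) :
    ∃ y, 0 ≤ y ∧ y ≤ π / 2 ∧ ∀ n : ℕ, |Real.sin (n * x)| = |Real.sin (n * y)| := by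
  refine ⟨|x - round (x / π) * π|, abs_nonneg _, ?_, fun n => ?_⟩
  · have h := abs_sub_round (x / π)
    have h2 : x - round (x / π) * π = (x / π - round (x / π)) * π := by
      field_simp
    rw [h2, abs_mul, abs_of_pos Real.pi_pos]
    nlinarith [Real.pi_pos]
  · have h1 : |Real.sin (n * x)| = |Real.sin (n * (x - round (x / π) * π))| := by
      have : (n : ℝ) * (x - round (x / π) * π) = n * x - ((n * round (x / π) : ℤ) : ℝ) * π := by
        push_cast
        ring
      rw [this, Real.sin_sub_int_mul_pi, abs_mul]
      simp
    rw [h1]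
    rcases abs_choice (x - round (x / π) * π) with h | h <;> rw [h]
    rw [mul_neg, Real.sin_neg, abs_neg]

/-- `sin (n t) / sin t` is nonincreasing in `t` on `(0, π / (2n)]`. -/
lemma sin_nat_mul_mul_sin_le (n : ℕ) {x y : ℝ} (hx : 0 < x) (hxy : x ≤ y)
    (hy : n * y ≤ π / 2) :
    Real.sin (n * y) * Real.sin x ≤ Real.sin (n * x) * Real.sin y := by
  induction n with
  | zero => simp
  | succ n ih =>
    rcases Nat.eq_zero_or_pos n with rfl | hn
    · simp [mul_comm]
    have hn1 : (1 : ℝ) ≤ n := by exact_mod_cast hn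
    push_cast at hy ⊢
    have hny : n * y ≤ π / 2 := by nlinarith
    have hy2 : y ≤ π / 2 := by nlinarith
    have hnx : n * x ≤ n * y := by nlinarith
    have ih := ih hny
    have hsx : 0 ≤ Real.sin x := Real.sin_nonneg_of_nonneg_of_le_pi hx.le (by linarith)
    have hsy : 0 ≤ Real.sin y := Real.sin_nonneg_of_nonneg_of_le_pi (by linarith) (by linarith)
    have hsnx : 0 ≤ Real.sin (n * x) :=
      Real.sin_nonneg_of_nonneg_of_le_pi (by nlinarith) (by linarith)
    have hcy : 0 ≤ Real.cos y := Real.cos_nonneg_of_neg_pi_div_two_le_of_le (by linarith) hy2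
    have hc : Real.cos y ≤ Real.cos x :=
      Real.cos_le_cos_of_nonneg_of_le_pi hx.le (by linarith) hxy
    have hcn : Real.cos (n * y) ≤ Real.cos (n * x) :=
      Real.cos_le_cos_of_nonneg_of_le_pi (by nlinarith) (by linarith) hnx
    rw [add_mul, add_mul, one_mul, one_mul, Real.sin_add, Real.sin_add]
    have h1 := mul_le_mul_of_nonneg_left ih hcy
    have h2 := mul_le_mul_of_nonneg_left hc (mul_nonneg hsnx hsy)
    have h3 := mul_le_mul_of_nonneg_left hcn (mul_nonneg hsx hsy)
    nlinarith

lemma abs_sin_nat_mul_mul_sin_le {q : ℕ} (hq : 1 ≤ q) {δ y : ℝ} (hδ : 0 < δ)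
    (hδ2 : δ ≤ π / 2) (hδy : δ / q ≤ y) (hy : y ≤ π / 2) :
    |Real.sin (q * y)| * Real.sin (δ / q) ≤ Real.sin δ * Real.sin y := by
  have hq0 : (0 : ℝ) < q := by exact_mod_cast hq
  have hq1 : (1 : ℝ) ≤ q := by exact_mod_cast hq
  have hdq : 0 < δ / q := by positivity
  have hdq' : q * (δ / q) = δ := by field_simp
  have hpos : 0 ≤ Real.sin (δ / q) :=
    Real.sin_nonneg_of_nonneg_of_le_pi hdq.le (by linarith)
  rcases le_total (q * y) (π / 2) with h | h
  · have := sin_nat_mul_mul_sin_le q hdq hδy h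
    rwa [hdq', ← abs_of_nonneg (Real.sin_nonneg_of_nonneg_of_le_pi
      (show 0 ≤ q * y by nlinarith) (by linarith [Real.pi_pos]))] at this
  · have h0 : q * (π / 2 / q) = π / 2 := by field_simp
    have h1 := sin_nat_mul_mul_sin_le q hdq (y := π / 2 / q) (by gcongr) h0.le
    rw [h0, hdq', Real.sin_pi_div_two] at h1
    have h2 : Real.sin (π / 2 / q) ≤ Real.sin y := by
      apply Real.sin_le_sin_of_le_of_le_pi_div_two _ hy
      · rw [div_le_iff₀ hq0]
        linarith
      · have : 0 ≤ π / 2 / q := by positivity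
        linarith [Real.pi_pos]
    have h3 : 0 ≤ Real.sin δ := Real.sin_nonneg_of_nonneg_of_le_pi hδ.le (by linarith)
    have h4 := Real.abs_sin_le_one (q * y)
    nlinarith [mul_le_mul_of_nonneg_left h2 h3, mul_le_mul_of_nonneg_right h4 hpos]

lemma norm_geom_sum_expTwo_le_of_sin_le {q : ℕ} (hq : 1 ≤ q) {δ x : ℝ} (hδ : 0 < δ)
    (hδ2 : δ ≤ π / 2) (h : Real.sin δ ≤ |Real.sin x| ∨ Real.sin δ ≤ |Real.sin (q * x)|) :
    ‖∑ d ∈ Finset.range q, expTwo x ^ d‖ ≤ Real.sin δ / Real.sin (δ / q) := by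
  obtain ⟨y, hy0, hy, hxy⟩ := exists_folded_angle x
  have hq0 : (0 : ℝ) < q := by exact_mod_cast hq
  have hq1 : (1 : ℝ) ≤ q := by exact_mod_cast hq
  have hdq : 0 < δ / q := by positivity
  have hdqle : δ / q ≤ δ := div_le_self hδ.le hq1
  have hsin1 : |Real.sin x| = Real.sin y := by
    have := hxy 1
    rw [Nat.cast_one, one_mul, one_mul] at this
    rw [this, abs_of_nonneg (Real.sin_nonneg_of_nonneg_of_le_pi hy0 (by linarith))]
  have hdy : δ / q ≤ y := by
    by_contra! hlt
    have hqy : q * y < δ := by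
      rw [lt_div_iff₀ hq0] at hlt
      linarith
    rcases h with h | h
    · rw [hsin1] at h
      have := Real.sin_lt_sin_of_lt_of_le_pi_div_two (x := y) (y := δ) (by linarith) hδ2
        (by linarith)
      linarith
    · rw [hxy q, abs_of_nonneg (Real.sin_nonneg_of_nonneg_of_le_pi (by positivity)
        (by linarith))] at h
      have hqy0 : 0 ≤ q * y := by positivity
      have := Real.sin_lt_sin_of_lt_of_le_pi_div_two (x := q * y) (y := δ) (by linarith) hδ2 hqy
      linarith
  have hkey := abs_sin_nat_mul_mul_sin_le hq hδ hδ2 hdy hy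
  have hF := norm_geom_sum_expTwo_mul q x
  rw [hsin1, hxy q] at hF
  have hsy : 0 < Real.sin y :=
    Real.sin_pos_of_pos_of_lt_pi (by linarith) (by linarith [Real.pi_pos])
  have hsd : 0 < Real.sin (δ / q) :=
    Real.sin_pos_of_pos_of_lt_pi hdq (by linarith [Real.pi_pos])
  rw [le_div_iff₀ hsd]
  rw [← hF] at hkey
  refine le_of_mul_le_mul_right ?_ hsy
  linarith

lemma abs_sin_sub_lt {δ x y : ℝ} (hδ : 0 ≤ δ) (hδ2 : δ ≤ π / 4)
    (hx : |Real.sin x| < Real.sin δ) (hy : |Real.sin y| < Real.sin δ) :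
    |Real.sin (x - y)| < Real.sin (2 * δ) := by
  have hpi := Real.pi_pos
  obtain ⟨x', hx0, hx2, hxx⟩ := exists_folded_angle x
  obtain ⟨y', hy0, hy2, hyy⟩ := exists_folded_angle y
  have hxx := hxx 1
  have hyy := hyy 1
  simp only [Nat.cast_one, one_mul] at hxx hyy
  have hcx : |Real.cos x| = |Real.cos x'| := by
    rw [Real.abs_cos_eq_sqrt_one_sub_sin_sq, Real.abs_cos_eq_sqrt_one_sub_sin_sq, ← sq_abs, hxx,
      sq_abs]
  have hcy : |Real.cos y| = |Real.cos y'| := by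
    rw [Real.abs_cos_eq_sqrt_one_sub_sin_sq, Real.abs_cos_eq_sqrt_one_sub_sin_sq, ← sq_abs, hyy,
      sq_abs]
  have hsx : |Real.sin x'| = Real.sin x' :=
    abs_of_nonneg (Real.sin_nonneg_of_nonneg_of_le_pi hx0 (by linarith))
  have hsy : |Real.sin y'| = Real.sin y' :=
    abs_of_nonneg (Real.sin_nonneg_of_nonneg_of_le_pi hy0 (by linarith))
  have hcx' : |Real.cos x'| = Real.cos x' :=
    abs_of_nonneg (Real.cos_nonneg_of_neg_pi_div_two_le_of_le (by linarith) hx2)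
  have hcy' : |Real.cos y'| = Real.cos y' :=
    abs_of_nonneg (Real.cos_nonneg_of_neg_pi_div_two_le_of_le (by linarith) hy2)
  have hlt : ∀ t, t ≤ π / 2 → 0 ≤ t → Real.sin t < Real.sin δ → t < δ := by
    intro t ht ht0 h
    by_contra! hc
    have := Real.sin_le_sin_of_le_of_le_pi_div_two (by linarith) ht hc
    linarith
  have h1 := hlt x' hx2 hx0 (by rw [← hsx, ← hxx]; exact hx)
  have h2 := hlt y' hy2 hy0 (by rw [← hsy, ← hyy]; exact hy)
  calc |Real.sin (x - y)| ≤ |Real.sin x| * |Real.cos y| + |Real.cos x| * |Real.sin y| := by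
        rw [Real.sin_sub, ← abs_mul, ← abs_mul]
        exact abs_sub _ _
    _ = Real.sin (x' + y') := by
        rw [hxx, hyy, hcx, hcy, hsx, hsy, hcx', hcy', Real.sin_add]
    _ < Real.sin (2 * δ) :=
        Real.sin_lt_sin_of_lt_of_le_pi_div_two (by linarith) (by linarith) (by linarith)

lemma sin_pi_div_le_abs_sin {b : ℕ} (hb : 2 ≤ b) {j : ℤ} (hj : ¬ (b : ℤ) ∣ j) :
    Real.sin (π / b) ≤ |Real.sin (π * j / b)| := by
  have hpi := Real.pi_pos
  have hb0 : (0 : ℝ) < b := by positivity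
  have hb2 : (2 : ℝ) ≤ b := by exact_mod_cast hb
  obtain ⟨y, hy0, hy2, hxy⟩ := exists_folded_angle (π * j / b)
  have h1 := hxy 1
  have h2 := hxy b
  simp only [Nat.cast_one, one_mul] at h1
  rw [h1, abs_of_nonneg (Real.sin_nonneg_of_nonneg_of_le_pi hy0 (by linarith))]
  have h3 : (b : ℝ) * (π * j / b) = j * π := by field_simp
  rw [h3, Real.sin_int_mul_pi, abs_zero] at h2
  apply Real.sin_le_sin_of_le_of_le_pi_div_two _ hy2
  · rw [div_le_iff₀ hb0]
    by_contra! hlt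
    have h4 := Real.sin_eq_zero_iff_of_lt_of_lt (x := b * y) (by nlinarith) (by linarith)
    have h5 : y = 0 := by
      have := h4.1 (abs_eq_zero.1 h2.symm)
      rcases mul_eq_zero.1 this with h | h
      · linarith
      · exact h
    rw [h5, Real.sin_zero, abs_zero, abs_eq_zero, Real.sin_eq_zero_iff] at h1
    obtain ⟨n, hn⟩ := h1
    apply hj
    refine ⟨n, ?_⟩
    have h6 : (j : ℝ) = b * n := by
      field_simp at hn
      linarith
    exact_mod_cast h6
  · have : 0 ≤ π / b := by positivity
    linarith

/-- Among two consecutive factors of the product formula, one is bounded by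
`sin (π / (2b)) / sin (π / (2bq))`. -/
lemma norm_geom_sum_expTwo_mul_le {q b k : ℕ} (hq : 2 ≤ q) (hb : 2 ≤ b)
    (hgcd : Nat.gcd b (q - 1) = 1) (hk : 0 < k) (hkb : k < b) (t : ℝ) :
    ‖∑ d ∈ Finset.range q, expTwo (π * k / b + t) ^ d‖ *
        ‖∑ d ∈ Finset.range q, expTwo (π * k / b + q * t) ^ d‖ ≤
      q * (Real.sin (π / (2 * b)) / Real.sin (π / (2 * b) / q)) := by
  have hpi := Real.pi_pos
  have hb0 : (0 : ℝ) < b := by positivity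
  have hb2 : (2 : ℝ) ≤ b := by exact_mod_cast hb
  have hδ : 0 < π / (2 * b) := by positivity
  have hδ4 : π / (2 * b) ≤ π / 4 := by
    apply div_le_div_of_nonneg_left hpi.le (by norm_num) (by linarith)
  have hδ2 : π / (2 * b) ≤ π / 2 := by linarith
  have hq1 : 1 ≤ q := by omega
  set α := π * k / b with hα
  have hndvd : ¬ (b : ℤ) ∣ (((q - 1) * k : ℕ) : ℤ) := by
    rw [Int.natCast_dvd_natCast]
    intro h
    have := Nat.Coprime.dvd_of_dvd_mul_left (show Nat.Coprime b (q - 1) from hgcd) h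
    exact absurd (Nat.le_of_dvd hk this) (by omega)
  have hsin := sin_pi_div_le_abs_sin hb hndvd
  have hdiff : π * (((q - 1) * k : ℕ) : ℤ) / b = q * (α + t) - (α + q * t) := by
    rw [hα]
    push_cast [Nat.cast_sub hq1]
    field_simp
    ring
  have h2δ : π / b = 2 * (π / (2 * b)) := by field_simp
  rw [hdiff, h2δ] at hsin
  have hcases : Real.sin (π / (2 * b)) ≤ |Real.sin (q * (α + t))| ∨
      Real.sin (π / (2 * b)) ≤ |Real.sin (α + q * t)| := by
    by_contra! h
    exact absurd (abs_sin_sub_lt hδ.le hδ4 h.1 h.2) (not_lt.2 hsin)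
  rcases hcases with h | h
  · rw [mul_comm]
    exact mul_le_mul (norm_geom_sum_expTwo_le _ _)
      (norm_geom_sum_expTwo_le_of_sin_le hq1 hδ hδ2 (Or.inr h)) (norm_nonneg _) (by positivity)
  · exact mul_le_mul (norm_geom_sum_expTwo_le _ _)
      (norm_geom_sum_expTwo_le_of_sin_le hq1 hδ hδ2 (Or.inl h)) (norm_nonneg _) (by positivity)

lemma sqd_mul_add {q : ℕ} (hq : 2 ≤ q) (n : ℕ) {d : ℕ} (hd : d < q) :
    sqd q (q * n + d) = sqd q n + d := by
  unfold sqd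
  by_cases h : d ≠ 0 ∨ n ≠ 0
  · rw [add_comm, Nat.digits_add q (by omega) d n hd h, List.sum_cons, add_comm]
  · push Not at h
    simp [h.1, h.2]

/-- The exponential sum `∑_{n < N} e^{2i(α s_q(n) + t n)}`. -/
noncomputable def digitExpSum (q : ℕ) (α t : ℝ) (N : ℕ) : ℂ :=
  ∑ n ∈ Finset.range N, expTwo α ^ sqd q n * expTwo t ^ n

lemma norm_digitExpSum_le (q : ℕ) (α t : ℝ) (N : ℕ) : ‖digitExpSum q α t N‖ ≤ N := by
  refine (norm_sum_le _ _).trans ?_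
  simp [norm_pow, norm_expTwo]

lemma digitExpSum_mul {q : ℕ} (hq : 2 ≤ q) (α t : ℝ) (K : ℕ) :
    digitExpSum q α t (q * K) =
      (∑ d ∈ Finset.range q, expTwo (α + t) ^ d) * digitExpSum q α (q * t) K := by
  induction K with
  | zero => simp [digitExpSum]
  | succ K ih =>
    unfold digitExpSum at ih ⊢
    rw [mul_add, mul_one, Finset.sum_range_add, ih, Finset.sum_range_succ, mul_add]
    congr 1
    rw [Finset.sum_mul]
    refine Finset.sum_congr rfl fun d hd => ?_
    rw [sqd_mul_add hq K (Finset.mem_range.1 hd), expTwo_add, ← expTwo_pow]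
    ring

lemma norm_digitExpSum_le_mul_add {q : ℕ} (hq : 2 ≤ q) (α t : ℝ) (N : ℕ) :
    ‖digitExpSum q α t N‖ ≤
      ‖∑ d ∈ Finset.range q, expTwo (α + t) ^ d‖ * ‖digitExpSum q α (q * t) (N / q)‖ + q := by
  have hsplit : digitExpSum q α t N = digitExpSum q α t (q * (N / q)) +
      ∑ d ∈ Finset.range (N % q),
        expTwo α ^ sqd q (q * (N / q) + d) * expTwo t ^ (q * (N / q) + d) := by
    unfold digitExpSum
    rw [← Finset.sum_range_add, Nat.div_add_mod]
  rw [hsplit, digitExpSum_mul hq, ← norm_mul]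
  refine (norm_add_le _ _).trans (add_le_add_right ?_ _)
  refine (norm_sum_le _ _).trans ?_
  simpa [norm_pow, norm_expTwo] using (Nat.mod_lt N (by omega : 0 < q)).le

lemma sin_ratio_mem {q b : ℕ} (hq : 2 ≤ q) (hb : 2 ≤ b) :
    1 ≤ Real.sin (π / (2 * b)) / Real.sin (π / (2 * b) / q) ∧
      Real.sin (π / (2 * b)) / Real.sin (π / (2 * b) / q) < q := by
  have hpi := Real.pi_pos
  have hb2 : (2 : ℝ) ≤ b := by exact_mod_cast hb
  have hq2 : (2 : ℝ) ≤ q := by exact_mod_cast hq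
  set δ := π / (2 * b) with hδdef
  have hδ : 0 < δ := by positivity
  have hδ4 : δ ≤ π / 4 := div_le_div_of_nonneg_left hpi.le (by norm_num) (by linarith)
  have hdq : 0 < δ / q := by positivity
  have hdq2 : δ / q ≤ δ / 2 := div_le_div_of_nonneg_left hδ.le (by norm_num) hq2
  have hs : 0 < Real.sin (δ / q) := Real.sin_pos_of_pos_of_lt_pi hdq (by linarith)
  constructor
  · rw [le_div_iff₀ hs, one_mul]
    exact Real.sin_le_sin_of_le_of_le_pi_div_two (by linarith) (by linarith) (by linarith)
  · rw [div_lt_iff₀ hs]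
    have h0 : (0 : ℝ) ∈ Set.Icc 0 π := ⟨le_rfl, hpi.le⟩
    have h1 : δ ∈ Set.Icc 0 π := ⟨hδ.le, by linarith⟩
    have hinv : (q : ℝ)⁻¹ < 1 := inv_lt_one_of_one_lt₀ (by linarith)
    have h := strictConcaveOn_sin_Icc.2 h0 h1 hδ.ne (sub_pos.2 hinv)
      (show 0 < (q : ℝ)⁻¹ by positivity) (by ring)
    simp only [smul_eq_mul, mul_zero, Real.sin_zero, zero_add] at h
    rw [inv_mul_lt_iff₀ (by linarith), inv_mul_eq_div] at h
    exact h

lemma gelfondLambda_eq (q b : ℕ) :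
    gelfondLambda q b = Real.log (q * (Real.sin (π / (2 * b)) / Real.sin (π / (2 * b) / q))) /
      (2 * Real.log q) := by
  rw [gelfondLambda, div_div π (2 * (b : ℝ)), mul_div_assoc]
  ring

lemma gelfondLambda_lt_one {q b : ℕ} (hq : 2 ≤ q) (hb : 2 ≤ b) : gelfondLambda q b < 1 := by
  obtain ⟨h1, h2⟩ := sin_ratio_mem hq hb
  have hq1 : (1 : ℝ) < q := by exact_mod_cast hq
  have hlog := Real.log_pos hq1
  rw [gelfondLambda_eq, div_lt_one (by positivity),
    Real.log_mul (by positivity) (by positivity)]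
  have := Real.log_lt_log (by linarith) h2
  linarith

lemma gelfondLambda_pos {q b : ℕ} (hq : 2 ≤ q) (hb : 2 ≤ b) : 0 < gelfondLambda q b := by
  obtain ⟨h1, h2⟩ := sin_ratio_mem hq hb
  have hq1 : (1 : ℝ) < q := by exact_mod_cast hq
  have hlog := Real.log_pos hq1
  rw [gelfondLambda_eq]
  exact div_pos (Real.log_pos (by nlinarith)) (by positivity)

lemma sq_rpow_gelfondLambda {q b : ℕ} (hq : 2 ≤ q) (hb : 2 ≤ b) :
    ((q : ℝ) * q) ^ gelfondLambda q b =
      q * (Real.sin (π / (2 * b)) / Real.sin (π / (2 * b) / q)) := by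
  obtain ⟨h1, h2⟩ := sin_ratio_mem hq hb
  have hq1 : (1 : ℝ) < q := by exact_mod_cast hq
  have hlog := Real.log_pos hq1
  rw [Real.rpow_def_of_pos (by positivity), Real.log_mul (by positivity) (by positivity),
    gelfondLambda_eq, ← two_mul, mul_div_cancel₀ _ (by positivity), Real.exp_log (by positivity)]

lemma norm_digitExpSum_le_rpow {q b k : ℕ} (hq : 2 ≤ q) (hb : 2 ≤ b)
    (hgcd : Nat.gcd b (q - 1) = 1) (hk : 0 < k) (hkb : k < b) {N : ℕ} (hN : 0 < N) (t : ℝ) :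
    ‖digitExpSum q (π * k / b) t N‖ ≤
      3 * (q : ℝ) ^ 2 * (N : ℝ) ^ gelfondLambda q b - 2 * (q : ℝ) ^ 2 := by
  induction N using Nat.strong_induction_on generalizing t with
  | _ N ih =>
  have hlam := gelfondLambda_pos hq hb
  have hpow := sq_rpow_gelfondLambda hq hb
  have hpair := norm_geom_sum_expTwo_mul_le hq hb hgcd hk hkb t
  obtain ⟨hM, -⟩ := sin_ratio_mem hq hb
  set lam := gelfondLambda q b
  set M := Real.sin (π / (2 * b)) / Real.sin (π / (2 * b) / q)
  set α := π * k / b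
  have hq2 : (2 : ℝ) ≤ q := by exact_mod_cast hq
  have hN1 : (1 : ℝ) ≤ (N : ℝ) ^ lam :=
    Real.one_le_rpow (by exact_mod_cast hN) hlam.le
  rcases lt_or_ge N (q * q) with hlt | hge
  · have h1 := norm_digitExpSum_le q α t N
    have h2 : (N : ℝ) ≤ q * q := by exact_mod_cast hlt.le
    nlinarith
  · have hK : 0 < N / q / q := by
      rw [Nat.div_div_eq_div_mul]
      exact Nat.div_pos hge (by positivity)
    have hKN : N / q / q < N := by
      rw [Nat.div_div_eq_div_mul]
      exact Nat.div_lt_self hN (by nlinarith)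
    have hih := ih _ hKN hK (q * (q * t))
    have h1 := norm_digitExpSum_le_mul_add hq α t N
    have h2 := norm_digitExpSum_le_mul_add hq α (q * t) (N / q)
    have hF := norm_geom_sum_expTwo_le q (α + t)
    have hKpow : q * M * ((N / q / q : ℕ) : ℝ) ^ lam ≤ (N : ℝ) ^ lam := by
      rw [← hpow, ← Real.mul_rpow (by positivity) (by positivity)]
      apply Real.rpow_le_rpow (by positivity) _ hlam.le
      rw [Nat.div_div_eq_div_mul]
      exact_mod_cast Nat.mul_div_le N (q * q)
    set A := ‖∑ d ∈ Finset.range q, expTwo (α + t) ^ d‖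
    set B := ‖∑ d ∈ Finset.range q, expTwo (α + q * t) ^ d‖
    set X := ‖digitExpSum q α (q * (q * t)) (N / q / q)‖
    set P := ((N / q / q : ℕ) : ℝ) ^ lam
    have hA : 0 ≤ A := norm_nonneg _
    have hX : 0 ≤ X := norm_nonneg _
    have hqM : 2 ≤ q * M := by nlinarith
    calc ‖digitExpSum q α t N‖ ≤ A * (B * X + q) + q :=
          h1.trans (by gcongr)
      _ ≤ q * M * X + q * q + q := by
          nlinarith [mul_le_mul_of_nonneg_right hpair hX]
      _ ≤ q * M * (3 * (q : ℝ) ^ 2 * P - 2 * (q : ℝ) ^ 2) + q * q + q := by gcongr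
      _ ≤ 3 * (q : ℝ) ^ 2 * (N : ℝ) ^ lam - 2 * (q : ℝ) ^ 2 := by
          nlinarith [mul_le_mul_of_nonneg_left hKpow (show 0 ≤ 3 * (q : ℝ) ^ 2 by positivity),
            mul_le_mul_of_nonneg_left hqM (show 0 ≤ 2 * (q : ℝ) ^ 2 by positivity)]

lemma expTwo_pi_mul_div_pow {b : ℕ} (hb : b ≠ 0) (j : ℕ) :
    expTwo (π * j / b) ^ b = 1 := by
  rw [expTwo_pow, expTwo, Complex.exp_eq_one_iff]
  refine ⟨j, ?_⟩
  have : (b : ℂ) ≠ 0 := by exact_mod_cast hb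
  push_cast
  field_simp

lemma sum_expTwo_pi_mul_div {b : ℕ} (hb : 2 ≤ b) (j : ℕ) :
    ∑ k ∈ Finset.range b, expTwo (π * k / b) ^ j = if b ∣ j then (b : ℂ) else 0 := by
  have hb0 : (b : ℝ) ≠ 0 := by positivity
  have hswap : ∀ k ∈ Finset.range b, expTwo (π * k / b) ^ j = expTwo (π * j / b) ^ k := by
    intro k _
    rw [expTwo_pow, expTwo_pow]
    congr 1
    ring
  rw [Finset.sum_congr rfl hswap]
  split_ifs with h
  · obtain ⟨c, rfl⟩ := h
    have h1 : π * ((b * c : ℕ) : ℝ) / b = c * π := by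
      push_cast
      field_simp
    have : expTwo (π * ((b * c : ℕ) : ℝ) / b) = 1 := by
      rw [← sub_eq_zero, ← norm_eq_zero, norm_expTwo_sub_one, h1, Real.sin_nat_mul_pi]
      simp
    rw [this]
    simp
  · have hne : expTwo (π * j / b) ≠ 1 := by
      intro h1
      have h2 := sin_pi_div_le_abs_sin hb (j := j) (by exact_mod_cast h)
      have h3 := norm_expTwo_sub_one (π * j / b)
      rw [h1, sub_self, norm_zero] at h3
      have h4 : 0 < Real.sin (π / b) := by
        apply Real.sin_pos_of_pos_of_lt_pi (by positivity)
        exact div_lt_self Real.pi_pos (by exact_mod_cast hb)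
      push_cast at h2
      linarith
    rw [geom_sum_eq hne, expTwo_pi_mul_div_pow (by omega), sub_self, zero_div]

lemma dvd_add_sub_iff {n b a : ℕ} (ha : a < b) : b ∣ n + (b - a) ↔ n % b = a := by
  have h1 : n + (b - a) + a = n + b := by omega
  constructor
  · intro h
    have h2 : (n + b) ≡ a [MOD b] := by
      rw [← h1]
      simpa using (Nat.modEq_zero_iff_dvd.2 h).add_right a
    simpa [Nat.ModEq, Nat.mod_eq_of_lt ha] using h2
  · intro h
    have h2 : n + (b - a) = b * (n / b + 1) := by
      have := Nat.div_add_mod n b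
      rw [mul_add, mul_one]
      omega
    exact ⟨_, h2⟩

/-- The exponential sum over a residue class is controlled by the full exponential sums. -/
lemma norm_sum_filter_mod_le {q m r N : ℕ} (hm : 2 ≤ m) (hr : r < m) {α D : ℝ}
    (hD : ∀ t, ‖digitExpSum q α t N‖ ≤ D) :
    ‖∑ n ∈ (Finset.range N).filter (fun n => n % m = r), expTwo α ^ sqd q n‖ ≤ D := by
  have hm0 : (0 : ℝ) < m := by positivity
  have hid : (m : ℂ) * ∑ n ∈ (Finset.range N).filter (fun n => n % m = r), expTwo α ^ sqd q n =
      ∑ h ∈ Finset.range m,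
        expTwo (π * h / m) ^ (m - r) * digitExpSum q α (π * h / m) N := by
    simp only [digitExpSum, Finset.mul_sum]
    rw [Finset.sum_comm, Finset.sum_filter]
    refine Finset.sum_congr rfl fun n _ => ?_
    have h1 := sum_expTwo_pi_mul_div hm (n + (m - r))
    simp only [dvd_add_sub_iff hr] at h1
    have h2 : ∀ h ∈ Finset.range m, expTwo (π * h / m) ^ (m - r) *
        (expTwo α ^ sqd q n * expTwo (π * h / m) ^ n) =
        expTwo α ^ sqd q n * expTwo (π * h / m) ^ (n + (m - r)) := by
      intro h _
      ring
    rw [Finset.sum_congr rfl h2, ← Finset.mul_sum, h1]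
    split_ifs <;> ring
  have hnorm := congrArg norm hid
  rw [norm_mul, Complex.norm_natCast] at hnorm
  have hle : ‖∑ h ∈ Finset.range m,
        expTwo (π * h / m) ^ (m - r) * digitExpSum q α (π * h / m) N‖ ≤ m * D := by
    refine (norm_sum_le _ _).trans ?_
    refine (Finset.sum_le_card_nsmul _ _ D fun h _ => ?_).trans (by simp)
    rw [norm_mul, norm_pow, norm_expTwo, one_pow, one_mul]
    exact hD _
  rw [← hnorm] at hle
  exact le_of_mul_le_mul_left hle hm0

lemma abs_card_filter_mod_sub_le {m r : ℕ} (hm : 0 < m) (hr : r < m) (N : ℕ) :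
    |(((Finset.range N).filter (fun n => n % m = r)).card : ℝ) - N / m| ≤ 1 := by
  have h := Nat.count_modEq_card N hm r
  have hm0 : (0 : ℝ) < m := by exact_mod_cast hm
  simp only [Nat.count_eq_card_filter_range, Nat.ModEq, Nat.mod_eq_of_lt hr] at h
  rw [h]
  have h1 : (N : ℝ) = m * (N / m : ℕ) + (N % m : ℕ) := by exact_mod_cast (Nat.div_add_mod N m).symm
  have h2 : ((N % m : ℕ) : ℝ) < m := by exact_mod_cast Nat.mod_lt N hm
  have h3 : (N : ℝ) / m = (N / m : ℕ) + ((N % m : ℕ) : ℝ) / m := by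
    rw [div_eq_iff hm0.ne', add_mul, div_mul_cancel₀ _ hm0.ne', ← mul_comm (m : ℝ)]
    exact h1
  have h4 : ((N % m : ℕ) : ℝ) / m ≤ 1 := by
    rw [div_le_one hm0]
    exact h2.le
  have h5 : 0 ≤ ((N % m : ℕ) : ℝ) / m := by positivity
  rw [h3, abs_le]
  split_ifs <;> push_cast <;> constructor <;> linarith

lemma mul_card_filter_eq {q b m a r : ℕ} (hb : 2 ≤ b) (ha : a < b) (N : ℕ) :
    (b : ℂ) * ((Finset.range N).filter (fun n => sqd q n % b = a ∧ n % m = r)).card =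
      ∑ k ∈ Finset.range b, expTwo (π * k / b) ^ (b - a) *
        ∑ n ∈ (Finset.range N).filter (fun n => n % m = r), expTwo (π * k / b) ^ sqd q n := by
  simp only [Finset.mul_sum]
  rw [Finset.sum_comm, Finset.sum_filter, Finset.card_filter, Nat.cast_sum, Finset.mul_sum]
  refine Finset.sum_congr rfl fun n _ => ?_
  have h1 := sum_expTwo_pi_mul_div hb (sqd q n + (b - a))
  simp only [dvd_add_sub_iff ha] at h1
  simp only [← pow_add, add_comm (b - a), h1]
  by_cases h2 : sqd q n % b = a <;> by_cases h3 : n % m = r <;> simp [h2, h3]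

theorem stmt19 (q b m a r : ℕ) (hq : 2 ≤ q) (hb : 2 ≤ b) (hm : 2 ≤ m)
    (hgcd : Nat.gcd b (q - 1) = 1) (ha : a < b) (hr : r < m) :
    gelfondLambda q b < 1 ∧
      ∃ C : ℝ, 0 < C ∧ ∀ N : ℕ,
        |(((Finset.range N).filter (fun n => sqd q n % b = a ∧ n % m = r)).card : ℝ) -
            (N : ℝ) / ((b : ℝ) * m)| ≤ C * (N : ℝ) ^ gelfondLambda q b := by
  refine ⟨gelfondLambda_lt_one hq hb, 3 * (q : ℝ) ^ 2 + 1, by positivity, fun N => ?_⟩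
  have hlam := gelfondLambda_pos hq hb
  rcases Nat.eq_zero_or_pos N with rfl | hN
  · simp [Real.zero_rpow hlam.ne']
  have hb0 : (0 : ℝ) < b := by positivity
  have hm0 : (0 : ℝ) < m := by positivity
  set P := (N : ℝ) ^ gelfondLambda q b
  have hP1 : 1 ≤ P := Real.one_le_rpow (by exact_mod_cast hN) hlam.le
  set S := ((Finset.range N).filter (fun n => sqd q n % b = a ∧ n % m = r)).card
  set R := ((Finset.range N).filter (fun n => n % m = r)).card with hR
  have hsum := mul_card_filter_eq (q := q) (m := m) (r := r) hb ha N
  obtain ⟨c, rfl⟩ : ∃ c, b = c + 1 := ⟨b - 1, by omega⟩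
  rw [Finset.sum_range_succ', ← sub_eq_iff_eq_add] at hsum
  have hzero : expTwo 0 = 1 := by simp [expTwo]
  have hbound : ‖((c + 1 : ℕ) : ℂ) * S - R‖ ≤ c * (3 * (q : ℝ) ^ 2 * P) := by
    have hR' : (R : ℂ) = expTwo (π * (0 : ℕ) / (c + 1 : ℕ)) ^ (c + 1 - a) *
        ∑ n ∈ (Finset.range N).filter (fun n => n % m = r),
          expTwo (π * (0 : ℕ) / (c + 1 : ℕ)) ^ sqd q n := by
      simp [hzero, hR]
    rw [hR', hsum]
    refine (norm_sum_le _ _).trans ?_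
    refine (Finset.sum_le_card_nsmul _ _ (3 * (q : ℝ) ^ 2 * P) fun k hk => ?_).trans (by simp)
    rw [norm_mul, norm_pow, norm_expTwo, one_pow, one_mul]
    refine norm_sum_filter_mod_le hm hr fun t => ?_
    have hk' := Finset.mem_range.1 hk
    have := norm_digitExpSum_le_rpow hq hb hgcd (Nat.succ_pos k) (by omega) hN t
    have hq0 : 0 ≤ 2 * (q : ℝ) ^ 2 := by positivity
    linarith
  have hcast : ((c + 1 : ℕ) : ℂ) * S - R = (((c + 1 : ℕ) * S - R : ℝ) : ℂ) := by push_cast; ring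
  rw [hcast, Complex.norm_real, Real.norm_eq_abs] at hbound
  have hcount := abs_card_filter_mod_sub_le (by omega : 0 < m) hr N
  have htri := abs_add_le (((c + 1 : ℕ) : ℝ) * S - R) (R - N / m)
  have heq : ((c + 1 : ℕ) : ℝ) * S - R + (R - N / m) =
      (c + 1 : ℕ) * (S - N / (((c + 1 : ℕ) : ℝ) * m)) := by
    field_simp
    ring
  rw [heq, abs_mul, abs_of_pos hb0] at htri
  refine le_of_mul_le_mul_left ?_ hb0
  have hc : ((c + 1 : ℕ) : ℝ) = c + 1 := by push_cast; ring
  have hc0 : (0 : ℝ) ≤ c := by positivity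
  have hX : 0 ≤ 3 * (q : ℝ) ^ 2 * P := by positivity
  calc _ ≤ c * (3 * (q : ℝ) ^ 2 * P) + 1 := by linarith
    _ ≤ ((c + 1 : ℕ) : ℝ) * ((3 * (q : ℝ) ^ 2 + 1) * P) := by
      rw [hc]
      nlinarith
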